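/- arXiv:1412.5831 — 3 statements merged into one kernel-verified Lean document; each statement's English description precedes it below -/
import Mathlib

section
/- Let K ≥ 3 and let p ∈ 𝔓_>([L]). Suppose X_1,…,X_K ∈ Gl_1(L) and p' ∈ 𝔓_>([L]) satisfy p^{(K)} = (X_1⊗…⊗X_K) p'^{(K)}. Then there exists a permutation τ of [L] such that p'(i) = p(τ(i)) for all i ∈ [L] and X_1 = … = X_K = P_τ, where P_τ is the permutation matrix defined by P_τ δ_i = δ_{τ(i)}. Conversely, for every permutation τ of [L], the choice X_1 = … = X_K = P_τ together with p' defined by p'(i) = p(τ(i)) satisfies p^{(K)} = (X_1⊗…⊗X_K) p'^{(K)}. -/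
open scoped BigOperators

/-- `p` is a probability distribution on `Fin L` with all entries strictly positive. -/
def probPos {L : ℕ} (p : Fin L → ℝ) : Prop :=
  (∀ i, 0 < p i) ∧ ∑ i, p i = 1

/-- `p^{(K)}`: the function on `[L]^K` equal to `p i` on the constant tuple `(i,…,i)`
and `0` elsewhere. -/
def diagEmbed {L : ℕ} (p : Fin L → ℝ) (K : ℕ) : (Fin K → Fin L) → ℝ :=
  fun y => ∑ i, if (∀ k, y k = i) then p i else 0

/-- The action of `X_1 ⊗ … ⊗ X_K` on functions `[L]^K → ℝ`. -/
def tensorAct {L L' K : ℕ} (X : Fin K → Matrix (Fin L') (Fin L) ℝ)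
    (v : (Fin K → Fin L) → ℝ) : (Fin K → Fin L') → ℝ :=
  fun y => ∑ x : Fin K → Fin L, v x * ∏ k, X k (y k) (x k)

/-- `Gl_1(L)`: invertible matrices whose columns each sum to `1`. -/
def Gl1 {L : ℕ} (X : Matrix (Fin L) (Fin L) ℝ) : Prop :=
  IsUnit X ∧ ∀ j, ∑ i, X i j = 1

/-- The permutation matrix `P_τ` with `P_τ δ_j = δ_{τ j}`. -/
def permMat {L : ℕ} (τ : Equiv.Perm (Fin L)) : Matrix (Fin L) (Fin L) ℝ :=
  fun i j => if i = τ j then 1 else 0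

/-- Summing a function against a tuple concentrated on the diagonal. -/
theorem sum_diagEmbed_mul {L K : ℕ} (p : Fin L → ℝ) (F : (Fin K → Fin L) → ℝ) :
    ∑ x, diagEmbed p K x * F x = ∑ i, p i * F (fun _ => i) := by
  simp only [diagEmbed, Finset.sum_mul]
  rw [Finset.sum_comm]
  refine Finset.sum_congr rfl fun i _ => ?_
  rw [Finset.sum_eq_single (fun _ => i)]
  · simp
  · intro x _ hx
    rw [if_neg fun h => hx (funext h), zero_mul]
  · simp

theorem tensorAct_diagEmbed {L L' K : ℕ} (X : Fin K → Matrix (Fin L') (Fin L) ℝ)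
    (p : Fin L → ℝ) (y : Fin K → Fin L') :
    tensorAct X (diagEmbed p K) y = ∑ j, p j * ∏ k, X k (y k) j :=
  sum_diagEmbed_mul p fun x => ∏ k, X k (y k) (x k)

/-- Testing the tensor equation against a product of functions of the separate coordinates. -/
theorem sum_mul_prod_eq_of_diagEmbed_eq {L L' K : ℕ} {X : Fin K → Matrix (Fin L') (Fin L) ℝ}
    {p : Fin L' → ℝ} {p' : Fin L → ℝ} (h : diagEmbed p K = tensorAct X (diagEmbed p' K))
    (f : Fin K → Fin L' → ℝ) :
    ∑ i, p i * ∏ k, f k i = ∑ j, p' j * ∏ k, ∑ a, f k a * X k a j := by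
  rw [← sum_diagEmbed_mul p fun y => ∏ k, f k (y k), h]
  simp only [tensorAct_diagEmbed, Finset.sum_mul]
  rw [Finset.sum_comm]
  refine Finset.sum_congr rfl fun j _ => ?_
  rw [Fintype.prod_sum, Finset.mul_sum]
  refine Finset.sum_congr rfl fun y _ => ?_
  rw [Finset.prod_mul_distrib]
  ring

theorem prod_eq_mul_mul_of_eq_one {ι : Type*} [Fintype ι] [DecidableEq ι] {M : Type*}
    [CommMonoid M] {k l m : ι} (hkl : k ≠ l) (hkm : k ≠ m) (hlm : l ≠ m) (F : ι → M)
    (hF : ∀ n, n ≠ k → n ≠ l → n ≠ m → F n = 1) :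
    ∏ n, F n = F k * (F l * F m) := by
  rw [← Finset.prod_subset (Finset.subset_univ {k, l, m})]
  · rw [Finset.prod_insert (by simp [hkl, hkm]), Finset.prod_pair hlm]
  · intro n _ hn
    simp only [Finset.mem_insert, Finset.mem_singleton, not_or] at hn
    exact hF n hn.1 hn.2.1 hn.2.2

/-- The three-coordinate marginal of the tensor equation, tested against a product function. -/
theorem sum_mul_three_eq {L L' K : ℕ} {X : Fin K → Matrix (Fin L') (Fin L) ℝ}
    {p : Fin L' → ℝ} {p' : Fin L → ℝ} (hX : ∀ k j, ∑ i, X k i j = 1)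
    (h : diagEmbed p K = tensorAct X (diagEmbed p' K))
    {k l m : Fin K} (hkl : k ≠ l) (hkm : k ≠ m) (hlm : l ≠ m) (u v w : Fin L' → ℝ) :
    ∑ i, p i * (u i * (v i * w i)) =
      ∑ j, p' j * ((∑ a, u a * X k a j) * ((∑ a, v a * X l a j) * ∑ a, w a * X m a j)) := by
  have key := sum_mul_prod_eq_of_diagEmbed_eq h
    (fun n => if n = k then u else if n = l then v else if n = m then w else fun _ => 1)
  convert key using 3
  · rw [prod_eq_mul_mul_of_eq_one hkl hkm hlm]
    · simp [hkl.symm, hkm.symm, hlm.symm]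
    · intro n h1 h2 h3
      simp [h1, h2, h3]
  · rw [prod_eq_mul_mul_of_eq_one hkl hkm hlm]
    · simp [hkl.symm, hkm.symm, hlm.symm]
    · intro n h1 h2 h3
      simp [h1, h2, h3, hX]

/-- In a given column, a nonzero entry of one factor forces the column of any other factor to be the
corresponding standard basis vector. -/
theorem apply_mul_apply_eq {L K : ℕ} {X : Fin K → Matrix (Fin L) (Fin L) ℝ}
    {p p' : Fin L → ℝ} (hX : ∀ k, Gl1 (X k)) (hp' : ∀ j, 0 < p' j)
    (h : diagEmbed p K = tensorAct X (diagEmbed p' K))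
    {k l m : Fin K} (hkl : k ≠ l) (hkm : k ≠ m) (hlm : l ≠ m) (a c j : Fin L) :
    X k a j * X m c j = if a = c then X k a j else 0 := by
  have hdet : IsUnit (X l).det := (Matrix.isUnit_iff_isUnit_det _).1 (hX l).1
  have hg : ∀ j', ∑ b, (X l)⁻¹ j b * X l b j' = if j = j' then 1 else 0 := fun j' => by
    rw [← Matrix.mul_apply, Matrix.nonsing_inv_mul _ hdet, Matrix.one_apply]
  have key := sum_mul_three_eq (fun k => (hX k).2) h hkl hkm hlm
    (fun i => if i = a then 1 else 0) ((X l)⁻¹ j)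
  have h1 := key fun _ => 1
  have h2 := key fun i => if i = c then 1 else 0
  simp only [hg, (hX _).2, one_mul, mul_one, ite_mul, mul_ite, zero_mul, mul_zero,
    Finset.sum_ite_eq, Finset.sum_ite_eq', Finset.mem_univ, if_true] at h1 h2
  apply mul_left_cancel₀ (hp' j).ne'
  rw [← h2]
  by_cases hac : a = c
  · subst hac
    simpa using h1
  · simp [hac, Ne.symm hac]

theorem exists_apply_ne_zero_of_sum_eq_one {ι : Type*} [Fintype ι] {f : ι → ℝ}
    (hf : ∑ i, f i = 1) : ∃ i, f i ≠ 0 := by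
  by_contra! hc
  simp [hc] at hf

theorem exists_third {K : ℕ} (hK : 3 ≤ K) (k m : Fin K) : ∃ l, k ≠ l ∧ l ≠ m := by
  obtain ⟨l, hl⟩ := Finset.exists_mem_notMem_of_card_lt_card (s := {k, m}) (t := Finset.univ)
    (lt_of_le_of_lt Finset.card_le_two (by rw [Finset.card_univ, Fintype.card_fin]; omega))
  simp only [Finset.mem_insert, Finset.mem_singleton, not_or] at hl
  exact ⟨l, Ne.symm hl.2.1, hl.2.2⟩

/-- An invertible matrix whose columns are standard basis vectors permutes them. -/
theorem bijective_of_isUnit {L : ℕ} {A : Matrix (Fin L) (Fin L) ℝ} (hA : IsUnit A)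
    {t : Fin L → Fin L} (ht : ∀ i j, A i j = if i = t j then 1 else 0) :
    Function.Bijective t := by
  refine Finite.injective_iff_bijective.1 fun i j hij => ?_
  by_contra hne
  refine ((Matrix.isUnit_iff_isUnit_det _).1 hA).ne_zero
    (Matrix.det_zero_of_column_eq hne fun a => ?_)
  rw [ht, ht, hij]

theorem diagEmbed_eq_tensorAct_permMat {L : ℕ} (K : ℕ) (p : Fin L → ℝ)
    (τ : Equiv.Perm (Fin L)) :
    diagEmbed p K = tensorAct (fun _ => permMat τ) (diagEmbed (fun i => p (τ i)) K) := by
  funext y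
  rw [tensorAct_diagEmbed]
  simp only [diagEmbed, permMat, Fintype.prod_boole, mul_ite, mul_one, mul_zero]
  exact (Equiv.sum_comp τ fun i => if ∀ k, y k = i then p i else 0).symm

theorem uniqueness_of_solution (L K : ℕ) (hL : 1 ≤ L) (hK : 3 ≤ K)
    (p : Fin L → ℝ) (hp : probPos p) :
    (∀ (X : Fin K → Matrix (Fin L) (Fin L) ℝ) (p' : Fin L → ℝ),
      (∀ k, Gl1 (X k)) → probPos p' →
      diagEmbed p K = tensorAct X (diagEmbed p' K) →
      ∃ τ : Equiv.Perm (Fin L),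
        (∀ i, p' i = p (τ i)) ∧ ∀ k, X k = permMat τ)
    ∧
    (∀ τ : Equiv.Perm (Fin L),
      diagEmbed p K
        = tensorAct (fun _ => permMat τ) (diagEmbed (fun i => p (τ i)) K)) := by
  refine ⟨fun X p' hX hp' h => ?_, diagEmbed_eq_tensorAct_permMat K p⟩
  have col : ∀ k m, k ≠ m → ∀ a j, X k a j ≠ 0 → ∀ c, X m c j = if c = a then 1 else 0 := by
    intro k m hkm a j ha c
    obtain ⟨l, hkl, hlm⟩ := exists_third hK k m
    apply mul_left_cancel₀ ha
    rw [apply_mul_apply_eq hX hp'.1 h hkl hkm hlm]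
    simp [eq_comm]
  let k₀ : Fin K := ⟨0, by omega⟩
  let k₁ : Fin K := ⟨1, by omega⟩
  have h01 : k₀ ≠ k₁ := by simp [k₀, k₁]
  choose t ht using fun j => exists_apply_ne_zero_of_sum_eq_one ((hX k₀).2 j)
  have hcol : ∀ k i j, X k i j = if i = t j then 1 else 0 := by
    intro k i j
    by_cases hk : k₀ = k
    · subst hk
      refine col k₁ k₀ h01.symm (t j) j ?_ i
      simp [col k₀ k₁ h01 (t j) j (ht j)]
    · exact col k₀ k hk (t j) j (ht j) i
  let τ := Equiv.ofBijective t (bijective_of_isUnit (hX k₀).1 (hcol k₀))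
  have hXτ : X = fun _ => permMat τ := funext fun k => Matrix.ext fun i j => hcol k i j
  refine ⟨τ, fun i => ?_, fun k => congrFun hXτ k⟩
  obtain ⟨k₂, h02, h21⟩ := exists_third hK k₀ k₁
  have key := sum_mul_three_eq (fun k => (hX k).2) h h02 h01 h21
    (fun a => if a = τ i then 1 else 0) (fun _ => 1) (fun _ => 1)
  simpa [(hX _).2, hXτ, permMat, τ.injective.eq_iff, eq_comm] using key.symm
end

section
/- Let K ≥ 3. The map Θ sending a tuple (p, T_1,…,T_K) to the distribution (T_1⊗…⊗T_K) p^{(K)} on [L]^K is injective when restricted to tuples in which p ∈ 𝔓↓([L]) ∩ 𝔓_>([L]) and each T_k ∈ 𝒲([L],[L]) is invertible as a matrix. In particular, there is a function Θ'' from distributions on [L]^K to such tuples with Θ''(Θ(p,T_1,…,T_K)) = (p,T_1,…,T_K) for all such tuples. -/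
open scoped BigOperators

/-- `p` is a probability distribution on `Fin L`. -/
def probDist {L : ℕ} (p : Fin L → ℝ) : Prop :=
  (∀ i, 0 ≤ p i) ∧ ∑ i, p i = 1

/-- A channel from `[L]` to `[L']`: an `L' × L` column-stochastic matrix. -/
def isChannel {L L' : ℕ} (W : Matrix (Fin L') (Fin L) ℝ) : Prop :=
  (∀ i j, 0 ≤ W i j) ∧ ∀ j, ∑ i, W i j = 1

/-- `p` has strictly decreasing entries: `p 1 > p 2 > … > p L`. -/
def strictDecr {L : ℕ} (p : Fin L → ℝ) : Prop :=
  ∀ i j : Fin L, i < j → p j < p i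

open Matrix in
/-- Pairing `(T_1 ⊗ … ⊗ T_K) p^{(K)}` with a product test function. -/
lemma sum_prod_mul_tensorAct_diagEmbed {L L' K : ℕ} (p : Fin L → ℝ)
    (T : Fin K → Matrix (Fin L') (Fin L) ℝ) (f : Fin K → Fin L' → ℝ) :
    ∑ y, (∏ k, f k (y k)) * tensorAct T (diagEmbed p K) y
      = ∑ i, p i * ∏ k, (f k ᵥ* T k) i := by
  have key : ∀ y, tensorAct T (diagEmbed p K) y = ∑ i, p i * ∏ k, T k (y k) i := by
    intro y
    simp only [tensorAct, diagEmbed, Finset.sum_mul]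
    rw [Finset.sum_comm]
    refine Finset.sum_congr rfl fun i _ => ?_
    rw [Finset.sum_eq_single (fun _ => i)]
    · simp
    · intro x _ hx
      rw [if_neg, zero_mul]
      exact fun h => hx (funext h)
    · simp
  simp only [key, Finset.mul_sum]
  rw [Finset.sum_comm]
  refine Finset.sum_congr rfl fun i _ => ?_
  simp only [vecMul, dotProduct]
  rw [Fintype.prod_sum, Finset.mul_sum]
  refine Finset.sum_congr rfl fun y _ => ?_
  rw [Finset.prod_mul_distrib]
  ring

open Matrix in
/-- A matrix acting multiplicatively and unitally on functions is given by precomposition. -/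
lemma exists_vecMul_eq_comp {m n : Type*} [Fintype m] [DecidableEq m] (S : Matrix m n ℝ)
    (hone : (1 : m → ℝ) ᵥ* S = 1)
    (hmul : ∀ f g : m → ℝ, (f * g) ᵥ* S = (f ᵥ* S) * (g ᵥ* S)) :
    ∃ σ : n → m, ∀ f : m → ℝ, f ᵥ* S = f ∘ σ := by
  have hentry : ∀ j, ∃ i, S i j ≠ 0 := by
    intro j
    by_contra! h
    have := congrFun hone j
    simp [vecMul, dotProduct, h] at this
  choose σ hσ using hentry
  refine ⟨σ, fun f => funext fun j => ?_⟩
  have h := congrFun (hmul f (Pi.single (σ j) 1)) j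
  have h2 : f * Pi.single (σ j) 1 = f (σ j) • (Pi.single (σ j) 1 : m → ℝ) := by
    ext i
    by_cases hi : i = σ j
    · subst hi; simp
    · simp [hi]
  rw [h2, smul_vecMul] at h
  simp only [Pi.smul_apply, Pi.mul_apply, single_one_vecMul, smul_eq_mul, row_apply] at h
  exact (mul_right_cancel₀ (hσ j) h).symm

open Matrix in
/-- The diagonal three-way tensor of a strictly decreasing positive distribution is fixed only
by the identity. -/
lemma eq_one_of_diagonal_trilinear {L : ℕ} {p p' : Fin L → ℝ} (hp : strictDecr p)
    (hpos' : ∀ i, 0 < p' i) (hp' : strictDecr p') {S₁ S₂ S₃ : Matrix (Fin L) (Fin L) ℝ}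
    (h₁ : (1 : Fin L → ℝ) ᵥ* S₁ = 1) (h₂ : (1 : Fin L → ℝ) ᵥ* S₂ = 1)
    (h₃ : (1 : Fin L → ℝ) ᵥ* S₃ = 1) (u₁ : IsUnit S₁) (u₃ : IsUnit S₃)
    (H : ∀ f g h : Fin L → ℝ, ∑ i, p i * (f i * g i * h i)
      = ∑ i, p' i * ((f ᵥ* S₁) i * (g ᵥ* S₂) i * (h ᵥ* S₃) i)) :
    p = p' ∧ S₁ = 1 := by
  have hmul₂ : ∀ f g : Fin L → ℝ, (f * g) ᵥ* S₁ = (f ᵥ* S₁) * (g ᵥ* S₂) := by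
    intro f g
    ext j
    obtain ⟨h, hh⟩ := (vecMul_surjective_iff_isUnit.2 u₃) (Pi.single j 1)
    simp only at hh
    have e₁ := H (f * g) 1 h
    have e₂ := H f g h
    rw [h₂, hh] at e₁
    rw [hh] at e₂
    simp only [Pi.mul_apply, Pi.one_apply, mul_one] at e₁
    rw [e₁] at e₂
    simpa [Pi.single_apply, (hpos' j).ne'] using e₂
  have h₁₂ : ∀ g : Fin L → ℝ, g ᵥ* S₁ = g ᵥ* S₂ := by
    intro g
    simpa [h₁] using hmul₂ 1 g
  obtain ⟨σ, hσ⟩ := exists_vecMul_eq_comp S₁ h₁ fun f g => by rw [hmul₂, h₁₂ g]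
  have hinj : Function.Injective σ := by
    intro a b hab
    obtain ⟨f, hf⟩ := (vecMul_surjective_iff_isUnit.2 u₁) (Pi.single a 1)
    simp only [hσ] at hf
    by_contra hne
    have ha := congrFun hf a
    have hb := congrFun hf b
    rw [Function.comp_apply, hab, Pi.single_eq_same] at ha
    rw [Function.comp_apply, Pi.single_eq_of_ne' hne, ha] at hb
    exact one_ne_zero hb
  have hpσ : ∀ j, p (σ j) = p' j := by
    intro j
    have := H (Pi.single (σ j) 1) 1 1
    rw [hσ, h₂, h₃] at this
    simpa [Pi.single_apply, hinj.eq_iff] using this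
  have hanti : StrictAnti p := fun i j => hp i j
  have hmono : StrictMono σ := by
    intro a b hab
    rw [← hanti.lt_iff_gt, hpσ, hpσ]
    exact hp' a b hab
  have hid : ∀ j, σ j = j := fun j => le_antisymm hmono.apply_le hmono.le_apply
  refine ⟨funext fun j => ?_, ?_⟩
  · rw [← hpσ, hid]
  · ext i j
    have := congrFun (hσ (Pi.single i 1)) j
    rw [single_one_vecMul] at this
    simpa [hid, Pi.single_apply, one_apply, eq_comm] using this

open Matrix in
/-- Identifiability of the weights and of the first factor of a three-way mixture. -/
lemma eq_of_trilinear_eq {L : ℕ} {p p' : Fin L → ℝ} (hp : strictDecr p)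
    (hpos' : ∀ i, 0 < p' i) (hp' : strictDecr p') {A A' : Fin 3 → Matrix (Fin L) (Fin L) ℝ}
    (hA : ∀ k, isChannel (A k) ∧ IsUnit (A k)) (hA' : ∀ k, isChannel (A' k) ∧ IsUnit (A' k))
    (H : ∀ f g h : Fin L → ℝ,
      ∑ i, p i * ((f ᵥ* A 0) i * (g ᵥ* A 1) i * (h ᵥ* A 2) i)
        = ∑ i, p' i * ((f ᵥ* A' 0) i * (g ᵥ* A' 1) i * (h ᵥ* A' 2) i)) :
    p = p' ∧ A 0 = A' 0 := by
  have hdet : ∀ k, IsUnit (A k).det := fun k => (isUnit_iff_isUnit_det _).1 (hA k).2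
  have one_vecMul : ∀ W : Matrix (Fin L) (Fin L) ℝ, isChannel W → (1 : Fin L → ℝ) ᵥ* W = 1 := by
    intro W hW
    ext j
    simpa [vecMul, dotProduct] using hW.2 j
  have hone : ∀ k, (1 : Fin L → ℝ) ᵥ* ((A k)⁻¹ * A' k) = 1 := by
    intro k
    have : (1 : Fin L → ℝ) ᵥ* (A k)⁻¹ = 1 := by
      conv_lhs => rw [← one_vecMul _ (hA k).1]
      rw [vecMul_vecMul, mul_nonsing_inv _ (hdet k), vecMul_one]
    rw [← vecMul_vecMul, this, one_vecMul _ (hA' k).1]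
  have hunit : ∀ k, IsUnit ((A k)⁻¹ * A' k) := fun k =>
    ((isUnit_nonsing_inv_iff).2 (hA k).2).mul (hA' k).2
  obtain ⟨h, hS⟩ := eq_one_of_diagonal_trilinear hp hpos' hp' (hone 0) (hone 1) (hone 2)
    (hunit 0) (hunit 2) fun f g h => by
      have := H (f ᵥ* (A 0)⁻¹) (g ᵥ* (A 1)⁻¹) (h ᵥ* (A 2)⁻¹)
      simpa only [vecMul_vecMul, nonsing_inv_mul _ (hdet _), vecMul_one] using this
  refine ⟨h, ?_⟩
  have := congrArg (A 0 * ·) hS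
  simpa only [mul_nonsing_inv_cancel_left _ _ (hdet 0), mul_one, eq_comm] using this

open Matrix in
/-- Pairing with a test function supported on three distinct coordinates. -/
lemma trilinear_eq_of_tensorAct_eq {L K : ℕ} {p p' : Fin L → ℝ}
    {T T' : Fin K → Matrix (Fin L) (Fin L) ℝ} (hT : ∀ k, isChannel (T k))
    (hT' : ∀ k, isChannel (T' k))
    (H : tensorAct T (diagEmbed p K) = tensorAct T' (diagEmbed p' K))
    {a b c : Fin K} (hab : a ≠ b) (hac : a ≠ c) (hbc : b ≠ c) (f g h : Fin L → ℝ) :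
    ∑ i, p i * ((f ᵥ* T a) i * (g ᵥ* T b) i * (h ᵥ* T c) i)
      = ∑ i, p' i * ((f ᵥ* T' a) i * (g ᵥ* T' b) i * (h ᵥ* T' c) i) := by
  classical
  let F : Fin K → Fin L → ℝ := fun k =>
    if k = a then f else if k = b then g else if k = c then h else 1
  have hF : ∀ U : Fin K → Matrix (Fin L) (Fin L) ℝ, (∀ k, isChannel (U k)) → ∀ i,
      ∏ k, (F k ᵥ* U k) i = (f ᵥ* U a) i * (g ᵥ* U b) i * (h ᵥ* U c) i := by
    intro U hU i
    rw [← Finset.prod_subset (Finset.subset_univ {a, b, c})]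
    · rw [Finset.prod_insert (by simp [hab, hac]), Finset.prod_insert (by simp [hbc]),
        Finset.prod_singleton]
      simp [F, hab.symm, hac.symm, hbc.symm, mul_assoc]
    · intro k _ hk
      simp only [Finset.mem_insert, Finset.mem_singleton, not_or] at hk
      simpa [F, hk.1, hk.2.1, hk.2.2, vecMul, dotProduct] using (hU k).2 i
  have e := sum_prod_mul_tensorAct_diagEmbed p T F
  rw [H, sum_prod_mul_tensorAct_diagEmbed p' T' F] at e
  simpa only [hF T hT, hF T' hT'] using e.symm

/-- The weights and the factors are determined by the mixture. -/
lemma tensorAct_diagEmbed_injective {L K : ℕ} (hK : 3 ≤ K) {p p' : Fin L → ℝ}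
    {T T' : Fin K → Matrix (Fin L) (Fin L) ℝ} (hp : strictDecr p)
    (hT : ∀ k, isChannel (T k) ∧ IsUnit (T k)) (hpos' : ∀ i, 0 < p' i) (hp' : strictDecr p')
    (hT' : ∀ k, isChannel (T' k) ∧ IsUnit (T' k))
    (H : tensorAct T (diagEmbed p K) = tensorAct T' (diagEmbed p' K)) :
    p = p' ∧ T = T' := by
  have key : ∀ a, p = p' ∧ T a = T' a := by
    intro a
    obtain ⟨b, hb⟩ := Finset.exists_mem_notMem_of_card_lt_card (s := {a}) (t := Finset.univ)
      (by simp; omega)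
    obtain ⟨c, hc⟩ := Finset.exists_mem_notMem_of_card_lt_card (s := {a, b}) (t := Finset.univ)
      (lt_of_le_of_lt Finset.card_le_two (by simp; omega))
    simp only [Finset.mem_univ, Finset.mem_singleton, Finset.mem_insert, true_and, not_or]
      at hb hc
    exact eq_of_trilinear_eq hp hpos' hp' (A := ![T a, T b, T c]) (A' := ![T' a, T' b, T' c])
      (by simp [Fin.forall_fin_succ, hT]) (by simp [Fin.forall_fin_succ, hT'])
      (trilinear_eq_of_tensorAct_eq (fun k => (hT k).1) (fun k => (hT' k).1) H
        (Ne.symm hb) (Ne.symm hc.1) (Ne.symm hc.2))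
  exact ⟨(key ⟨0, by omega⟩).1, funext fun a => (key a).2⟩

theorem theta_injective (L K : ℕ) (hL : 1 ≤ L) (hK : 3 ≤ K) :
    (∀ (p p' : Fin L → ℝ) (T T' : Fin K → Matrix (Fin L) (Fin L) ℝ),
      probPos p → strictDecr p → (∀ k, isChannel (T k) ∧ IsUnit (T k)) →
      probPos p' → strictDecr p' → (∀ k, isChannel (T' k) ∧ IsUnit (T' k)) →
      tensorAct T (diagEmbed p K) = tensorAct T' (diagEmbed p' K) →
      p = p' ∧ T = T')
    ∧
    (∃ Θ'' : ((Fin K → Fin L) → ℝ) →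
        (Fin L → ℝ) × (Fin K → Matrix (Fin L) (Fin L) ℝ),
      ∀ (p : Fin L → ℝ) (T : Fin K → Matrix (Fin L) (Fin L) ℝ),
        probPos p → strictDecr p → (∀ k, isChannel (T k) ∧ IsUnit (T k)) →
        Θ'' (tensorAct T (diagEmbed p K)) = (p, T)) := by
  refine ⟨fun p p' T T' _ hp hT hpos' hp' hT' H =>
    tensorAct_diagEmbed_injective hK hp hT hpos'.1 hp' hT' H, ?_⟩
  classical
  let Q : ((Fin K → Fin L) → ℝ) → (Fin L → ℝ) × (Fin K → Matrix (Fin L) (Fin L) ℝ) → Prop :=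
    fun v q => probPos q.1 ∧ strictDecr q.1 ∧ (∀ k, isChannel (q.2 k) ∧ IsUnit (q.2 k)) ∧
      tensorAct q.2 (diagEmbed q.1 K) = v
  refine ⟨fun v => if h : ∃ q, Q v q then h.choose else 0, fun p T hpos hp hT => ?_⟩
  have h : ∃ q, Q (tensorAct T (diagEmbed p K)) q := ⟨(p, T), hpos, hp, hT, rfl⟩
  obtain ⟨-, hq, hqT, hqv⟩ := h.choose_spec
  refine (dif_pos h).trans ?_
  obtain ⟨h₁, h₂⟩ := tensorAct_diagEmbed_injective hK hq hqT hpos.1 hp hT hqv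
  exact Prod.ext h₁ h₂
end

section
/- Let K ≥ 3, let p, p' ∈ 𝔓_>([L]), and let V_1,…,V_K, W_1,…,W_K ∈ 𝒲([L],[L]) all be invertible as matrices. If (V_1⊗…⊗V_K) p^{(K)} = (W_1⊗…⊗W_K) p'^{(K)}, then there exists a permutation τ of [L] such that p'(i) = p(τ(i)) for all i ∈ [L] and W_k δ_i = V_k δ_{τ(i)} for all k ∈ [K] and i ∈ [L] (i.e., the two channel families differ only by the single joint permutation τ). -/
open scoped BigOperators

open Matrix in
/-- Pairing `(X_1 ⊗ … ⊗ X_K) p^{(K)}` with a product of functions. -/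
theorem sum_tensorAct_diagEmbed_mul_prod {L L' K : ℕ}
    (X : Fin K → Matrix (Fin L') (Fin L) ℝ) (p : Fin L → ℝ) (f : Fin K → Fin L' → ℝ) :
    ∑ y, tensorAct X (diagEmbed p K) y * ∏ k, f k (y k) =
      ∑ i, p i * ∏ k, (f k ᵥ* X k) i := by
  have h_diag (y : Fin K → Fin L') :
      tensorAct X (diagEmbed p K) y = ∑ i, p i * ∏ k, X k (y k) i := by
    simp only [tensorAct, diagEmbed, Finset.sum_mul]
    rw [Finset.sum_comm]
    refine Finset.sum_congr rfl fun i _ => ?_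
    rw [Finset.sum_eq_single (fun _ => i)]
    · simp
    · intro x _ hx
      rw [if_neg fun h => hx (funext h), zero_mul]
    · simp
  simp only [h_diag, Finset.sum_mul]
  rw [Finset.sum_comm]
  refine Finset.sum_congr rfl fun i _ => ?_
  simp only [vecMul, dotProduct, Finset.prod_univ_sum, Fintype.piFinset_univ, Finset.mul_sum]
  refine Finset.sum_congr rfl fun y _ => ?_
  rw [Finset.prod_mul_distrib]
  ring

open Matrix in
/-- The channel condition on column sums, as a statement about the all-ones vector. -/
theorem isChannel.one_vecMul {L L' : ℕ} {W : Matrix (Fin L') (Fin L) ℝ} (h : isChannel W) :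
    1 ᵥ* W = 1 := by
  ext j
  simpa [vecMul, dotProduct] using h.2 j

open Matrix in
/-- A change of coordinates between two diagonal tensors of order at least three has factors with
disjoint off-diagonal supports. -/
theorem mul_eq_zero_of_diagonal_tensor_eq {L K : ℕ} (hK : 3 ≤ K) {p p' : Fin L → ℝ}
    (hp' : ∀ i, p' i ≠ 0) {U : Fin K → Matrix (Fin L) (Fin L) ℝ} (hU : ∀ k, IsUnit (U k))
    (h : ∀ g : Fin K → Fin L → ℝ,
      ∑ i, p i * ∏ k, g k i = ∑ i, p' i * ∏ k, (g k ᵥ* U k) i)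
    {a b : Fin K} (hab : a ≠ b) {r s : Fin L} (hrs : r ≠ s) (j : Fin L) :
    U a r j * U b s j = 0 := by
  obtain ⟨c, hc⟩ : ∃ c, c ∉ ({a, b} : Finset (Fin K)) := by
    by_contra! hall
    have hcard := Finset.card_le_card (fun x _ => hall x : Finset.univ ⊆ _)
    have := Finset.card_le_two (a := a) (b := b)
    simp only [Finset.card_univ, Fintype.card_fin] at hcard
    omega
  simp only [Finset.mem_insert, Finset.mem_singleton, not_or] at hc
  have h_inv (k : Fin K) : (Pi.single j 1 ᵥ* (U k)⁻¹) ᵥ* U k = Pi.single j 1 := by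
    rw [vecMul_vecMul, nonsing_inv_mul _ ((isUnit_iff_isUnit_det _).1 (hU k)), vecMul_one]
  let g : Fin K → Fin L → ℝ := fun k =>
    if k = a then Pi.single r 1 else if k = b then Pi.single s 1 else Pi.single j 1 ᵥ* (U k)⁻¹
  have hga : g a = Pi.single r 1 := if_pos rfl
  have hgb : g b = Pi.single s 1 := by simp [g, hab.symm]
  have hg (k : Fin K) (hka : k ≠ a) (hkb : k ≠ b) : g k = Pi.single j 1 ᵥ* (U k)⁻¹ := by
    simp [g, hka, hkb]
  have h_left : ∑ i, p i * ∏ k, g k i = 0 := by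
    refine Finset.sum_eq_zero fun i _ => ?_
    by_cases hi : i = r
    · rw [Finset.prod_eq_zero (Finset.mem_univ b), mul_zero]
      rw [hgb, Pi.single_eq_of_ne (by rwa [hi])]
    · rw [Finset.prod_eq_zero (Finset.mem_univ a), mul_zero]
      rw [hga, Pi.single_eq_of_ne hi]
  have h_right := h g
  rw [h_left, Finset.sum_eq_single j, eq_comm, mul_eq_zero, or_iff_right (hp' j),
    Finset.prod_eq_zero_iff] at h_right
  · obtain ⟨k, -, hk⟩ := h_right
    by_cases hka : k = a
    · subst hka
      rw [hga] at hk
      simp_all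
    · by_cases hkb : k = b
      · subst hkb
        rw [hgb] at hk
        simp_all
      · rw [hg k hka hkb, h_inv] at hk
        simp at hk
  · intro i _ hi
    rw [Finset.prod_eq_zero (Finset.mem_univ c), mul_zero]
    rw [hg c hc.1 hc.2, h_inv, Pi.single_eq_of_ne hi]
  · simp

/-- Two vectors of total mass one with disjoint off-diagonal supports are the same basis vector. -/
theorem exists_eq_single_of_mul_eq_zero {ι : Type*} [Fintype ι] [DecidableEq ι] {u v : ι → ℝ}
    (hu : ∑ i, u i = 1) (hv : ∑ i, v i = 1) (h : ∀ r s, r ≠ s → u r * v s = 0) :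
    ∃ i, u = Pi.single i 1 ∧ v = Pi.single i 1 := by
  obtain ⟨i, -, hi⟩ := Finset.exists_ne_zero_of_sum_ne_zero (hu.trans_ne one_ne_zero)
  have hv0 (s : ι) (hs : s ≠ i) : v s = 0 := (mul_eq_zero.1 (h i s hs.symm)).resolve_left hi
  have hvi : v i = 1 := by rw [← hv, Finset.sum_eq_single i (fun s _ => hv0 s) (by simp)]
  have hu0 (r : ι) (hr : r ≠ i) : u r = 0 :=
    (mul_eq_zero.1 (h r i hr)).resolve_right (by simp [hvi])
  have hui : u i = 1 := by rw [← hu, Finset.sum_eq_single i (fun s _ => hu0 s) (by simp)]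
  refine ⟨i, ?_, ?_⟩ <;> ext s <;> obtain rfl | hs := eq_or_ne s i <;> simp [*]

theorem channels_differ_by_joint_permutation (L K : ℕ) (hL : 1 ≤ L) (hK : 3 ≤ K)
    (p p' : Fin L → ℝ) (hp : probPos p) (hp' : probPos p')
    (V W : Fin K → Matrix (Fin L) (Fin L) ℝ)
    (hV : ∀ k, isChannel (V k) ∧ IsUnit (V k))
    (hW : ∀ k, isChannel (W k) ∧ IsUnit (W k))
    (heq : tensorAct V (diagEmbed p K) = tensorAct W (diagEmbed p' K)) :
    ∃ τ : Equiv.Perm (Fin L),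
      (∀ i, p' i = p (τ i)) ∧ ∀ (k : Fin K) (a i : Fin L), W k a i = V k a (τ i) := by
  open Matrix in
  have hVdet (k : Fin K) : IsUnit (V k).det := (isUnit_iff_isUnit_det _).1 (hV k).2
  let U : Fin K → Matrix (Fin L) (Fin L) ℝ := fun k => (V k)⁻¹ * W k
  have hVU (k : Fin K) : V k * U k = W k := mul_nonsing_inv_cancel_left _ _ (hVdet k)
  have hU (k : Fin K) : IsUnit (U k) :=
    ((isUnit_nonsing_inv_iff).2 (hV k).2).mul (hW k).2
  have h_one (k : Fin K) : 1 ᵥ* U k = 1 := by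
    rw [← (hV k).1.one_vecMul, vecMul_vecMul, hVU, (hW k).1.one_vecMul, (hV k).1.one_vecMul]
  have h_sum (k : Fin K) (j : Fin L) : ∑ i, U k i j = 1 := by
    simpa [vecMul, dotProduct] using congrFun (h_one k) j
  have h_diag (g : Fin K → Fin L → ℝ) :
      ∑ i, p i * ∏ k, g k i = ∑ i, p' i * ∏ k, (g k ᵥ* U k) i := by
    have h := sum_tensorAct_diagEmbed_mul_prod V p fun k => g k ᵥ* (V k)⁻¹
    rw [heq, sum_tensorAct_diagEmbed_mul_prod] at h
    simpa [vecMul_vecMul, nonsing_inv_mul _ (hVdet _)] using h.symm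
  have h_pair {a b : Fin K} (hab : a ≠ b) (j : Fin L) :
      ∃ i, (fun r => U a r j) = Pi.single i 1 ∧ (fun r => U b r j) = Pi.single i 1 :=
    exists_eq_single_of_mul_eq_zero (h_sum a j) (h_sum b j) fun _ _ hrs =>
      mul_eq_zero_of_diagonal_tensor_eq hK (fun i => (hp'.1 i).ne') hU h_diag hab hrs j
  let k₀ : Fin K := ⟨0, by omega⟩
  let k₁ : Fin K := ⟨1, by omega⟩
  have h_ne : k₀ ≠ k₁ := by simp [k₀, k₁]
  choose σ hσ using fun j => (h_pair h_ne j).imp fun _ h => h.1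
  have hσ' (k : Fin K) (j : Fin L) : (fun r => U k r j) = Pi.single (σ j) 1 := by
    obtain rfl | hk := eq_or_ne k k₀
    · exact hσ j
    · obtain ⟨i, hi, hi₀⟩ := h_pair hk j
      rw [hi, ← hi₀, hσ]
  have hσ_inj : Function.Injective σ := fun i j hij => by
    have h_col : U k₀ *ᵥ Pi.single i 1 = U k₀ *ᵥ Pi.single j 1 := by
      simp only [mulVec_single_one]
      exact (hσ i).trans ((congrArg (Pi.single · 1) hij).trans (hσ j).symm)
    have h := congrFun (mulVec_injective_of_isUnit (hU k₀) h_col) i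
    by_contra h_ij
    simp [h_ij] at h
  refine ⟨Equiv.ofBijective σ hσ_inj.bijective_of_finite, fun i => ?_, fun k a i => ?_⟩
  · have h := h_diag fun k => if k = k₀ then Pi.single (σ i) 1 else 1
    have h_left (j : Fin L) :
        ∏ k, (if k = k₀ then Pi.single (σ i) 1 else 1 : Fin L → ℝ) j =
          (Pi.single (σ i) 1 : Fin L → ℝ) j := by
      rw [Finset.prod_eq_single k₀ (by simp +contextual) (by simp), if_pos rfl]
    have h_right (j : Fin L) :
        ∏ k, ((if k = k₀ then Pi.single (σ i) 1 else 1 : Fin L → ℝ) ᵥ* U k) j =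
          (Pi.single i 1 : Fin L → ℝ) j := by
      rw [Finset.prod_eq_single k₀ (by simp +contextual [h_one]) (by simp), if_pos rfl,
        single_one_vecMul]
      have := congrFun (hσ j) (σ i)
      simp_all [Pi.single_apply, hσ_inj.eq_iff, eq_comm]
    simp only [h_left, h_right] at h
    simpa [Pi.single_apply] using h.symm
  · rw [← hVU, mul_apply]
    simp only [fun s => congrFun (hσ' k i) s]
    simp [Pi.single_apply]
end
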